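/- arXiv:1403.3111 — 8 statements merged into one kernel-verified Lean document; each statement's English description precedes it below -/
import Mathlib

section
/- Let E and F be real Banach spaces, U ⊆ E an open set, f : U → F a C^∞ map, and k ≥ 1 a natural number. If γ₁, γ₂ : ℝ → U are smooth curves with γ₁(0) = γ₂(0) and with equal iterated derivatives γ₁⁽ʲ⁾(0) = γ₂⁽ʲ⁾(0) for all 1 ≤ j ≤ k, then the compositions satisfy (f ∘ γ₁)⁽ʲ⁾(0) = (f ∘ γ₂)⁽ʲ⁾(0) for all 0 ≤ j ≤ k. (This is the well-definedness of the chart maps Ψ_α^k of the k-th order tangent bundle: k-th order contact of curves at a point is preserved by smooth maps.) -/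
/-- If two curves have the same derivatives of order `0, …, n` at `x`, then so do their
compositions with a map that is `n` times continuously differentiable at their common value. -/
theorem iteratedDeriv_vcomp_congr
    {𝕜 E F : Type*} [NontriviallyNormedField 𝕜] [NormedAddCommGroup E] [NormedSpace 𝕜 E]
    [NormedAddCommGroup F] [NormedSpace 𝕜 F] {n : ℕ} {g : E → F} {f₁ f₂ : 𝕜 → E} {x : 𝕜}
    (hg : ContDiffAt 𝕜 n g (f₁ x)) (hf₁ : ContDiffAt 𝕜 n f₁ x) (hf₂ : ContDiffAt 𝕜 n f₂ x)
    (h : ∀ i ≤ n, iteratedDeriv i f₁ x = iteratedDeriv i f₂ x) :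
    iteratedDeriv n (g ∘ f₁) x = iteratedDeriv n (g ∘ f₂) x := by
  have hx : f₁ x = f₂ x := by simpa using h 0 n.zero_le
  rw [iteratedDeriv_vcomp_eq_sum_orderedFinpartition hg hf₁ le_rfl,
    iteratedDeriv_vcomp_eq_sum_orderedFinpartition (hx ▸ hg) hf₂ le_rfl, hx]
  simp only [h _ (OrderedFinpartition.partSize_le _ _)]

/-- **Well-definedness of the chart maps of the k-th order tangent bundle.**
If two smooth curves through the same point of an open set `U` of a Banach space
have equal iterated derivatives at `0` up to order `k`, then so do their
compositions with any `C^∞` map `f` defined on `U`. -/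
theorem kth_order_contact_preserved
    {E F : Type*} [NormedAddCommGroup E] [NormedSpace ℝ E] [CompleteSpace E]
    [NormedAddCommGroup F] [NormedSpace ℝ F] [CompleteSpace F]
    (U : Set E) (hU : IsOpen U) (f : E → F) (hf : ContDiffOn ℝ (⊤ : ℕ∞) f U)
    (k : ℕ) (hk : 1 ≤ k)
    (γ₁ γ₂ : ℝ → E) (hγ₁ : ContDiff ℝ (⊤ : ℕ∞) γ₁) (hγ₂ : ContDiff ℝ (⊤ : ℕ∞) γ₂)
    (hmem₁ : ∀ t, γ₁ t ∈ U) (hmem₂ : ∀ t, γ₂ t ∈ U)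
    (h0 : γ₁ 0 = γ₂ 0)
    (hder : ∀ j, 1 ≤ j → j ≤ k → iteratedDeriv j γ₁ 0 = iteratedDeriv j γ₂ 0) :
    ∀ j, j ≤ k → iteratedDeriv j (f ∘ γ₁) 0 = iteratedDeriv j (f ∘ γ₂) 0 := by
  intro j hj
  have hjtop : (j : WithTop ℕ∞) ≤ ((⊤ : ℕ∞) : WithTop ℕ∞) := mod_cast le_top
  refine iteratedDeriv_vcomp_congr
    ((hf.contDiffAt (hU.mem_nhds (hmem₁ 0))).of_le hjtop)
    (hγ₁.contDiffAt.of_le hjtop) (hγ₂.contDiffAt.of_le hjtop) fun i hi => ?_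
  rcases Nat.eq_zero_or_pos i with rfl | hpos
  · simpa using h0
  · exact hder i hpos (hi.trans hj)
end

section
/- Let E and F be real Banach spaces, U ⊆ E open, f : U → F a C^∞ map, k ≥ 1, x ∈ U and ξ = (ξ₁, …, ξ_k) ∈ E^k. Let c_{x,ξ}(t) = x + Σ_{j=1}^k tʲ ξ_j. Then for every 1 ≤ i ≤ k, the i-th iterated derivative of t ↦ f(c_{x,ξ}(t)) at t = 0 equals Σ_{l=1}^{i} (i!/l!) Σ_{(j₁,…,j_l)} dˡf(x)(ξ_{j₁}, …, ξ_{j_l}), where the inner sum runs over all ordered compositions (j₁, …, j_l) of i into l positive integers (j₁ + ⋯ + j_l = i, each j_r ≥ 1), and dˡf(x) denotes the l-th iterated Fréchet derivative of f at x. (This is the explicit higher-order chain rule, equation (1) of the paper, evaluated along the polynomial curve c_{x,ξ}, and it computes the transition functions of T^kM.) -/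
open Filter Topology Asymptotics Finset in
/-- Taylor's theorem at a point of a normed space, with a big-O remainder. -/
theorem ContDiffAt.map_add_sub_sum_isBigO
    {E F : Type*} [NormedAddCommGroup E] [NormedSpace ℝ E]
    [NormedAddCommGroup F] [NormedSpace ℝ F] [CompleteSpace F]
    {f : E → F} {x : E} {n : ℕ} (hf : ContDiffAt ℝ (n + 1) f x) :
    (fun y => f (x + y) -
        ∑ l ∈ range (n + 1), (l.factorial : ℝ)⁻¹ • iteratedFDeriv ℝ l f x (fun _ => y))
      =O[𝓝 0] fun y => ‖y‖ ^ (n + 1) := by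
  have hcont : ContinuousAt (iteratedFDeriv ℝ (n + 1) f) x :=
    (hf.iteratedFDeriv_right (i := n + 1) (m := 0) (by simp)).continuousAt
  obtain ⟨M, hM⟩ := hcont.norm.isBoundedUnder_le
  have hsmooth : ∀ᶠ z in 𝓝 x, ContDiffAt ℝ (n + 1) f z :=
    hf.eventually (by exact_mod_cast WithTop.coe_ne_top)
  obtain ⟨δ, hδ, hball⟩ := Metric.eventually_nhds_iff_ball.1 (hsmooth.and hM)
  refine IsBigO.of_bound ((n.factorial : ℝ)⁻¹ * M) ?_
  filter_upwards [Metric.ball_mem_nhds (0 : E) hδ] with y hy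
  have hmem : ∀ s ∈ Set.Icc (0 : ℝ) 1, x + s • y ∈ Metric.ball x δ := by
    intro s hs
    rw [mem_ball_zero_iff] at hy
    rw [mem_ball_iff_norm, add_sub_cancel_left, norm_smul, Real.norm_of_nonneg hs.1]
    exact (mul_le_of_le_one_left (norm_nonneg y) hs.2).trans_lt hy
  rw [map_add_eq_sum_add_integral_iteratedFDeriv fun t ht => (hball _ (hmem t ht)).1,
    add_sub_cancel_left, norm_smul, norm_inv, Real.norm_natCast, norm_pow, norm_norm, mul_assoc]
  gcongr
  have hbound : ∀ s ∈ Set.uIoc (0 : ℝ) 1,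
      ‖(1 - s) ^ n • iteratedFDeriv ℝ (n + 1) f (x + s • y) (fun _ => y)‖
        ≤ M * ‖y‖ ^ (n + 1) := by
    intro s hs
    rw [Set.uIoc_of_le zero_le_one] at hs
    have hle : ‖(1 - s) ^ n‖ ≤ 1 := by
      rw [norm_pow]
      refine pow_le_one₀ (norm_nonneg _) ?_
      rw [Real.norm_of_nonneg (by linarith [hs.2])]
      linarith [hs.1]
    calc
      _ ≤ 1 * ‖iteratedFDeriv ℝ (n + 1) f (x + s • y) (fun _ => y)‖ := by
        rw [norm_smul]; gcongr
      _ ≤ ‖iteratedFDeriv ℝ (n + 1) f (x + s • y)‖ * ‖y‖ ^ (n + 1) := by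
        simpa using (iteratedFDeriv ℝ (n + 1) f (x + s • y)).le_opNorm (fun _ => y)
      _ ≤ M * ‖y‖ ^ (n + 1) := by
        gcongr
        exact (hball _ (hmem s ⟨hs.1.le, hs.2⟩)).2
  simpa using intervalIntegral.norm_integral_le_of_norm_le_const hbound

open Filter Topology Asymptotics Finset in
/-- If `g` is `C^n` at `0` and `g t = o(t^n)`, then the derivatives of `g` of order at most `n`
vanish at `0`. -/
theorem ContDiffAt.iteratedDeriv_eq_zero_of_isLittleO
    {F : Type*} [NormedAddCommGroup F] [NormedSpace ℝ F] {g : ℝ → F} {n : ℕ}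
    (hg : ContDiffAt ℝ n g 0) (ho : g =o[𝓝 0] fun t : ℝ => t ^ n) :
    ∀ j ≤ n, iteratedDeriv j g 0 = 0 := by
  induction n using Nat.strong_induction_on with
  | _ n ih =>
  have hlt : ∀ j < n, iteratedDeriv j g 0 = 0 := fun j hj =>
    ih j hj (hg.of_le (by exact_mod_cast hj.le))
      (ho.trans_isBigO (IsBigO.of_bound 1 (by
        filter_upwards [Metric.ball_mem_nhds (0 : ℝ) one_pos] with t ht
        rw [mem_ball_zero_iff] at ht
        rw [norm_pow, norm_pow, one_mul]
        exact pow_le_pow_of_le_one (norm_nonneg t) ht.le hj.le))) j le_rfl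
  intro j hj
  rcases hj.lt_or_eq with hj | rfl
  · exact hlt j hj
  obtain ⟨u, hu, hgu⟩ := hg.contDiffOn (m := j) le_rfl (by simp)
  obtain ⟨δ, hδ, hsub⟩ := Metric.mem_nhds_iff.1 hu
  have h0 : (0 : ℝ) ∈ Metric.ball (0 : ℝ) δ := Metric.mem_ball_self hδ
  have htaylor := taylor_isLittleO (convex_ball (0 : ℝ) δ) h0 (hgu.mono hsub)
  rw [nhdsWithin_eq_nhds.2 (Metric.ball_mem_nhds _ hδ)] at htaylor
  have heval : ∀ t : ℝ, taylorWithinEval g j (Metric.ball 0 δ) 0 t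
      = t ^ j • ((j.factorial : ℝ)⁻¹ • iteratedDeriv j g 0) := by
    intro t
    rw [taylor_within_apply, sum_range_succ, sum_eq_zero, zero_add,
      iteratedDerivWithin_of_isOpen Metric.isOpen_ball h0, sub_zero, smul_smul, mul_comm]
    intro l hl
    rw [iteratedDerivWithin_of_isOpen Metric.isOpen_ball h0, hlt l (mem_range.1 hl), smul_zero]
  simp only [heval, sub_zero] at htaylor
  have hlead := ho.sub htaylor
  simp only [sub_sub_cancel] at hlead
  have hconst : (fun _ : ℝ => (j.factorial : ℝ)⁻¹ • iteratedDeriv j g 0)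
      =o[𝓝[≠] 0] fun _ : ℝ => (1 : ℝ) := by
    have hmul := (isBigO_refl (fun t : ℝ => (t ^ j)⁻¹) (𝓝[≠] 0)).smul_isLittleO
      (hlead.mono nhdsWithin_le_nhds)
    refine hmul.congr' ?_ ?_ <;>
    · filter_upwards [self_mem_nhdsWithin] with t ht
      have : t ^ j ≠ 0 := pow_ne_zero _ ht
      simp [smul_smul, this]
  rw [isLittleO_one_iff, tendsto_const_nhds_iff] at hconst
  simpa [Nat.factorial_ne_zero] using hconst

open Finset in
/-- The `i`-th derivative at `0` of a continuous multilinear map evaluated on the diagonal along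
the polynomial curve `∑ j ∈ s, t ^ j • ξ j`. -/
theorem ContinuousMultilinearMap.iteratedDeriv_sum_pow_smul_zero
    {E F : Type*} [NormedAddCommGroup E] [NormedSpace ℝ E]
    [NormedAddCommGroup F] [NormedSpace ℝ F] {l : ℕ} (p : E [×l]→L[ℝ] F)
    (s : Finset ℕ) (ξ : ℕ → E) (i : ℕ) :
    iteratedDeriv i (fun t : ℝ => p (fun _ => ∑ j ∈ s, t ^ j • ξ j)) 0
      = (i.factorial : ℝ) •
          ∑ c ∈ (Fintype.piFinset fun _ : Fin l => s) with ∑ r, c r = i, p (fun r => ξ (c r)) := by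
  have hexpand : (fun t : ℝ => p (fun _ => ∑ j ∈ s, t ^ j • ξ j)) = fun t : ℝ =>
      ∑ c ∈ Fintype.piFinset fun _ : Fin l => s, t ^ (∑ r, c r) • p (fun r => ξ (c r)) := by
    ext t
    rw [p.map_sum_finset (fun _ j => t ^ j • ξ j) (fun _ => s)]
    refine sum_congr rfl fun c _ => ?_
    rw [p.map_smul_univ (fun r => t ^ c r), prod_pow_eq_pow_sum]
  rw [hexpand, iteratedDeriv_fun_sum fun c _ => by fun_prop, sum_filter, smul_sum]
  refine sum_congr rfl fun c _ => ?_
  have hsmul := iteratedDeriv_smul_const (n := i) (x := (0 : ℝ))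
    (f := fun t : ℝ => t ^ (∑ r, c r)) (by fun_prop) (p fun r => ξ (c r))
  rw [hsmul, iteratedDeriv_fun_pow_zero]
  by_cases h : ∑ r, c r = i
  · simp [h]
  · simp [h, Ne.symm h]

open Finset in
/-- The tuples in `{1, …, k}` with sum `i ≤ k` are the tuples of positive integers with sum `i`. -/
theorem Finset.Nat.filter_piFinset_Icc_sum_eq {k i : ℕ} (hik : i ≤ k) (l : ℕ) :
    (Fintype.piFinset fun _ : Fin l => Icc 1 k).filter (fun c => ∑ r, c r = i)
      = (Finset.Nat.antidiagonalTuple l i).filter (fun c => ∀ r, 1 ≤ c r) := by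
  ext c
  simp only [mem_filter, Fintype.mem_piFinset, mem_Icc, Finset.Nat.mem_antidiagonalTuple]
  refine ⟨fun ⟨h, hs⟩ => ⟨hs, fun r => (h r).1⟩, fun ⟨hs, h⟩ => ⟨fun r => ⟨h r, ?_⟩, hs⟩⟩
  exact (single_le_sum (f := c) (fun _ _ => Nat.zero_le _) (mem_univ r)).trans (hs.trans_le hik)


/-- **Explicit higher-order chain rule along a polynomial curve** (equation (1) of the paper).
For a `C^∞` map `f` on an open set `U` of a Banach space, `x ∈ U`,
and the polynomial curve `c t = x + ∑_{j=1}^k t^j ξ_j`, the `i`-th derivative of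
`t ↦ f (c t)` at `0` equals
`∑_{l=1}^i (i!/l!) ∑_{j₁+⋯+j_l = i, j_r ≥ 1} dˡf(x)(ξ_{j₁}, …, ξ_{j_l})`. -/
theorem higher_order_chain_rule_polynomial_curve
    {E F : Type*} [NormedAddCommGroup E] [NormedSpace ℝ E] [CompleteSpace E]
    [NormedAddCommGroup F] [NormedSpace ℝ F] [CompleteSpace F]
    (U : Set E) (hU : IsOpen U) (f : E → F) (hf : ContDiffOn ℝ (⊤ : ℕ∞) f U)
    (k : ℕ) (hk : 1 ≤ k) (x : E) (hx : x ∈ U) (ξ : ℕ → E) :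
    ∀ i, 1 ≤ i → i ≤ k →
      iteratedDeriv i (fun t : ℝ => f (x + ∑ j ∈ Finset.Icc 1 k, t ^ j • ξ j)) 0
        = ∑ l ∈ Finset.Icc 1 i, ((i.factorial : ℝ) / (l.factorial : ℝ)) •
            ∑ c ∈ (Finset.Nat.antidiagonalTuple l i).filter (fun c => ∀ r, 1 ≤ c r),
              iteratedFDeriv ℝ l f x (fun r => ξ (c r)) := by
  intro i hi hik
  set η : ℝ → E := fun t => ∑ j ∈ Finset.Icc 1 k, t ^ j • ξ j with hη
  set P : ℝ → F := fun t => ∑ l ∈ Finset.range (i + 1),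
    (l.factorial : ℝ)⁻¹ • iteratedFDeriv ℝ l f x (fun _ => η t) with hP
  have hfx : ContDiffAt ℝ (⊤ : ℕ∞) f x := hf.contDiffAt (hU.mem_nhds hx)
  have hη_zero : η 0 = 0 :=
    Finset.sum_eq_zero fun j hj => by
      simp [Nat.one_le_iff_ne_zero.1 (Finset.mem_Icc.1 hj).1]
  have hη_smooth (n : WithTop ℕ∞) : ContDiff ℝ n η := by fun_prop
  have hterm (l : ℕ) (n : WithTop ℕ∞) :
      ContDiff ℝ n fun t => iteratedFDeriv ℝ l f x (fun _ => η t) :=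
    (iteratedFDeriv ℝ l f x).contDiff.comp (contDiff_pi.2 fun _ => hη_smooth n)
  have hP_smooth : ContDiff ℝ i P :=
    ContDiff.sum fun l _ => (hterm l i).const_smul _
  have hcomp : ContDiffAt ℝ i (fun t => f (x + η t)) 0 := by
    refine ContDiffAt.comp (0 : ℝ) (g := f) ?_ (contDiff_const.add (hη_smooth i)).contDiffAt
    simpa [hη_zero] using hfx.of_le (by exact_mod_cast le_top)
  have hη_bigO : η =O[nhds 0] fun t : ℝ => t := by
    simpa [hη_zero] using ((hη_smooth 1).differentiable one_ne_zero 0).isBigO_sub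
  have hrem : (fun t => f (x + η t) - P t) =o[nhds 0] fun t : ℝ => t ^ i := by
    have hη_tendsto : Filter.Tendsto η (nhds 0) (nhds 0) := by
      simpa [hη_zero] using (hη_smooth 0).continuous.tendsto 0
    have htaylor : ContDiffAt ℝ (i + 1) f x := hfx.of_le (by exact_mod_cast le_top)
    refine (htaylor.map_add_sub_sum_isBigO.comp_tendsto hη_tendsto).trans_isLittleO ?_
    exact (hη_bigO.norm_left.pow (i + 1)).trans_isLittleO
      (Asymptotics.isLittleO_pow_pow (Nat.lt_succ_self i))
  have hderiv : iteratedDeriv i (fun t => f (x + η t)) 0 = iteratedDeriv i P 0 := by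
    rw [← sub_eq_zero, ← iteratedDeriv_fun_sub hcomp hP_smooth.contDiffAt]
    exact (hcomp.sub hP_smooth.contDiffAt).iteratedDeriv_eq_zero_of_isLittleO hrem i le_rfl
  rw [hderiv, hP, iteratedDeriv_fun_sum fun l _ => ((hterm l i).const_smul _).contDiffAt]
  simp only [iteratedDeriv_fun_const_smul_field, hη,
    ContinuousMultilinearMap.iteratedDeriv_sum_pow_smul_zero,
    Finset.Nat.filter_piFinset_Icc_sum_eq hik, smul_smul]
  have hinsert : Finset.range (i + 1) = insert 0 (Finset.Icc 1 i) := by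
    ext; simp; omega
  rw [hinsert, Finset.sum_insert (by simp)]
  obtain ⟨m, rfl⟩ := Nat.exists_eq_add_of_le' hi
  simp [div_eq_inv_mul]
end

section
/- Let E, F, G be real Banach spaces, U ⊆ E and V ⊆ F open, f : U → V and g : V → G C^∞ maps, and k ≥ 1. For a C^∞ map h on an open set and 1 ≤ i ≤ k set F_i^h(x,ξ) := (1/i!)·(dⁱ/dtⁱ)|_{t=0} h(x + Σ_{j=1}^k tʲ ξ_j), and define the k-jet prolongation J^k h(x,ξ) := (h(x), F_1^h(x,ξ), …, F_k^h(x,ξ)). Then for every (x,ξ) ∈ U × E^k one has J^k(g ∘ f)(x,ξ) = J^k g (J^k f(x,ξ)); that is, the first component of J^k(g∘f)(x,ξ) is g(f(x)) and for each 1 ≤ i ≤ k, F_i^{g∘f}(x,ξ) = F_i^g(f(x), F_1^f(x,ξ), …, F_k^f(x,ξ)). (This is the cocycle property of the transition maps Ψ^k_{βα} of Theorem 2.1: the k-jet prolongation is functorial.) -/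
theorem iteratedDeriv_comp_congr {F G : Type*} [NormedAddCommGroup F] [NormedSpace ℝ F]
    [NormedAddCommGroup G] [NormedSpace ℝ G] {g : F → G} {u v : ℝ → F} {t : ℝ} {n : ℕ}
    (hg : ContDiffAt ℝ n g (u t)) (hu : ContDiffAt ℝ n u t) (hv : ContDiffAt ℝ n v t)
    (huv : u t = v t)
    (h : ∀ m, 1 ≤ m → m ≤ n → iteratedDeriv m u t = iteratedDeriv m v t) :
    iteratedDeriv n (g ∘ u) t = iteratedDeriv n (g ∘ v) t := by
  rw [iteratedDeriv_vcomp_eq_sum_orderedFinpartition hg hu le_rfl,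
    iteratedDeriv_vcomp_eq_sum_orderedFinpartition (huv ▸ hg) hv le_rfl, huv]
  refine Finset.sum_congr rfl fun c _ => congrArg _ (funext fun j => ?_)
  exact h _ (c.partSize_pos j) (c.partSize_le j)

theorem contDiff_polynomialCurve {E : Type*} [NormedAddCommGroup E] [NormedSpace ℝ E] {k : ℕ}
    (x : E) (ξ : Fin k → E) {n : WithTop ℕ∞} :
    ContDiff ℝ n (fun t : ℝ => x + ∑ j : Fin k, t ^ ((j : ℕ) + 1) • ξ j) := by
  fun_prop

theorem polynomialCurve_zero {E : Type*} [NormedAddCommGroup E] [NormedSpace ℝ E] {k : ℕ}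
    (x : E) (ξ : Fin k → E) :
    x + ∑ j : Fin k, (0 : ℝ) ^ ((j : ℕ) + 1) • ξ j = x := by
  simp

theorem iteratedDeriv_succ_polynomialCurve_zero {E : Type*} [NormedAddCommGroup E]
    [NormedSpace ℝ E] {k : ℕ} (x : E) (ξ : Fin k → E) (i : Fin k) :
    iteratedDeriv ((i : ℕ) + 1) (fun t : ℝ => x + ∑ j : Fin k, t ^ ((j : ℕ) + 1) • ξ j) 0
      = (((i : ℕ) + 1).factorial : ℝ) • ξ i := by
  rw [iteratedDeriv_const_add (Nat.succ_pos _),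
    iteratedDeriv_fun_sum fun j _ => by fun_prop, Finset.sum_eq_single i]
  · rw [iteratedDeriv_smul_const (by fun_prop), iteratedDeriv_fun_pow_zero, if_pos rfl]
  · intro j _ hj
    rw [iteratedDeriv_smul_const (by fun_prop), iteratedDeriv_fun_pow_zero, if_neg, Nat.cast_zero,
      zero_smul]
    exact fun h => hj (Fin.ext (Nat.succ.inj h).symm)
  · simp


open scoped BigOperators

/-- The `i`-th `k`-jet component of a map `h` at `(x, ξ)`:
`F_i^h(x,ξ) = (1/i!) (dⁱ/dtⁱ)|_{t=0} h (x + ∑_{j=1}^k t^j ξ_j)`.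
(For `i = 0` this value is `h x`.) -/
noncomputable def jetComp {E F : Type*} [NormedAddCommGroup E] [NormedSpace ℝ E]
    [NormedAddCommGroup F] [NormedSpace ℝ F]
    (k : ℕ) (h : E → F) (x : E) (ξ : Fin k → E) (i : ℕ) : F :=
  ((1 : ℝ) / (i.factorial : ℝ)) •
    iteratedDeriv i (fun t : ℝ => h (x + ∑ j : Fin k, t ^ ((j : ℕ) + 1) • ξ j)) 0

/-- **Functoriality (cocycle property) of the k-jet prolongation** (Theorem 2.1):
`J^k (g ∘ f) (x, ξ) = J^k g (J^k f (x, ξ))`, i.e. the first component of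
`J^k (g∘f)(x,ξ)` is `g (f x)` and its `i`-th jet component, `1 ≤ i ≤ k`, equals the
`i`-th jet component of `g` at the point `(f x, F_1^f(x,ξ), …, F_k^f(x,ξ))`. -/
theorem jet_prolongation_comp
    {E F G : Type*} [NormedAddCommGroup E] [NormedSpace ℝ E] [CompleteSpace E]
    [NormedAddCommGroup F] [NormedSpace ℝ F] [CompleteSpace F]
    [NormedAddCommGroup G] [NormedSpace ℝ G] [CompleteSpace G]
    (U : Set E) (V : Set F) (hU : IsOpen U) (hV : IsOpen V)
    (f : E → F) (g : F → G) (hf : ContDiffOn ℝ (⊤ : ℕ∞) f U) (hg : ContDiffOn ℝ (⊤ : ℕ∞) g V)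
    (hfUV : Set.MapsTo f U V)
    (k : ℕ) (hk : 1 ≤ k) (x : E) (hx : x ∈ U) (ξ : Fin k → E) :
    (g ∘ f) x = g (f x) ∧
    ∀ i, 1 ≤ i → i ≤ k →
      jetComp k (g ∘ f) x ξ i
        = jetComp k g (f x) (fun j : Fin k => jetComp k f x ξ ((j : ℕ) + 1)) i := by
  refine ⟨rfl, fun i _ hik => ?_⟩
  set c : ℝ → E := fun t => x + ∑ j : Fin k, t ^ ((j : ℕ) + 1) • ξ j
  have hc0 : c 0 = x := polynomialCurve_zero x ξ
  have hgf : ContDiffAt ℝ i g (f x) :=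
    (hg.contDiffAt (hV.mem_nhds (hfUV hx))).of_le (by exact_mod_cast le_top)
  have hfc : ∀ n : ℕ, ContDiffAt ℝ n (f ∘ c) 0 := fun n => by
    refine ContDiffAt.comp 0 ?_ (contDiff_polynomialCurve x ξ).contDiffAt
    rw [hc0]
    exact (hf.contDiffAt (hU.mem_nhds hx)).of_le (by exact_mod_cast le_top)
  refine congrArg (((1 : ℝ) / (i.factorial : ℝ)) • ·) ?_
  refine iteratedDeriv_comp_congr (g := g) (u := f ∘ c) ?_ (hfc i)
    (contDiff_polynomialCurve _ _).contDiffAt ?_ ?_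
  · simpa only [Function.comp_apply, hc0] using hgf
  · rw [polynomialCurve_zero, Function.comp_apply, hc0]
  · intro m hm hmi
    obtain ⟨l, rfl⟩ := Nat.exists_eq_add_of_le' hm
    rw [iteratedDeriv_succ_polynomialCurve_zero _ _ (⟨l, hmi.trans hik⟩ : Fin k), jetComp,
      smul_smul, mul_one_div_cancel (Nat.cast_ne_zero.mpr (Nat.factorial_ne_zero _)), one_smul]
    rfl
end

section
/- Let E be a real Banach space and k ≥ 1. Let J : E × E^k → E × E^k be the continuous linear shift J(y, η₁, …, η_k) := (0, y, η₁, …, η_{k−1}), and let K : E × E^k → E^k be a continuous linear map with components K¹, …, K^k : E × E^k → E. Assume K^a = K^{a+1} ∘ J for all 1 ≤ a ≤ k−1, and K^k ∘ J^k = pr₀, where pr₀(y, η₁, …, η_k) = y and J^k is the k-fold iterate of J. Define continuous linear maps M^i : E → E by M^i y := K^i(y, 0, …, 0) for 1 ≤ i ≤ k. Then for every (y, η₁, …, η_k) ∈ E × E^k and every 1 ≤ i ≤ k: K^i(y, η₁, …, η_k) = η_i + M¹ η_{i−1} + M² η_{i−2} + ⋯ + M^{i−1} η₁ + M^i y. (This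 is Lemma 3.2: the local form, in a chart, of a connection map K : TT^kM → ⊕_{i=1}^k TM satisfying K^k ∘ J^a = K^{k−a} and K^k ∘ J^k = π_{k∗}.) -/
/-- The canonical shift `J : E × E^k → E × E^k`,
`J (y, η₁, …, η_k) = (0, y, η₁, …, η_{k−1})` (local form of the almost-tangent
endomorphism of `T T^k M`). -/
def shiftJ {E : Type*} [NormedAddCommGroup E] [NormedSpace ℝ E] (k : ℕ)
    (p : E × (Fin k → E)) : E × (Fin k → E) :=
  (0, fun i : Fin k =>
    if _h : (i : ℕ) = 0 then p.1
    else p.2 ⟨(i : ℕ) - 1, Nat.lt_of_le_of_lt (Nat.sub_le _ _) i.isLt⟩)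

/-- Every vector `(0, η)` is the shift of `(η₁, η₂, …, η_k, 0)`. -/
lemma shiftJ_shift_left {E : Type*} [NormedAddCommGroup E] [NormedSpace ℝ E] {k : ℕ}
    (hk : 0 < k) (η : Fin k → E) :
    shiftJ k (η ⟨0, hk⟩, fun j : Fin k => if h : (j : ℕ) + 1 < k then η ⟨j + 1, h⟩ else 0)
      = (0, η) := by
  refine Prod.ext rfl (funext fun ⟨i, hi⟩ => ?_)
  cases i with
  | zero => simp [shiftJ]
  | succ i => simp [shiftJ, hi]

/-- Iterating `K^a = K^{a+1} ∘ J`. -/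
lemma apply_zero_eq_apply_shiftJ_iterate
    {E : Type*} [NormedAddCommGroup E] [NormedSpace ℝ E] {k : ℕ}
    (K : E × (Fin k → E) → Fin k → E)
    (hshift : ∀ (a : ℕ) (ha : a + 1 < k) (p : E × (Fin k → E)),
      K p ⟨a, Nat.lt_of_succ_lt ha⟩ = K (shiftJ k p) ⟨a + 1, ha⟩)
    (b : ℕ) (hb : b < k) (p : E × (Fin k → E)) :
    K p ⟨0, Nat.zero_lt_of_lt hb⟩ = K ((shiftJ k)^[b] p) ⟨b, hb⟩ := by
  induction b with
  | zero => rfl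
  | succ b ih =>
    rw [ih (Nat.lt_of_succ_lt hb), hshift b hb, Function.iterate_succ_apply']

/-- **Lemma 3.2: local form of a connection map on `T^k M`.**
Let `K : E × E^k → E^k` be a continuous linear map with components
`K¹, …, K^k` satisfying `K^a = K^{a+1} ∘ J` for `1 ≤ a ≤ k−1` and
`K^k ∘ J^k = pr₀`.  With `Mⁱ y := Kⁱ (y, 0, …, 0)` one has, for all
`(y, η₁, …, η_k)` and `1 ≤ i ≤ k`,
`Kⁱ(y, η₁, …, η_k) = η_i + M¹ η_{i−1} + ⋯ + M^{i−1} η₁ + Mⁱ y`.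
(Indices below are 0-based: the Fin-index `i` stands for `K^{i+1}`.) -/
theorem connection_map_local_form
    {E : Type*} [NormedAddCommGroup E] [NormedSpace ℝ E] [CompleteSpace E]
    (k : ℕ) (hk : 1 ≤ k)
    (K : (E × (Fin k → E)) →L[ℝ] (Fin k → E))
    (hshift : ∀ (a : ℕ) (ha : a + 1 < k) (p : E × (Fin k → E)),
      K p ⟨a, Nat.lt_of_succ_lt ha⟩ = K (shiftJ k p) ⟨a + 1, ha⟩)
    (htop : ∀ p : E × (Fin k → E),
      K ((shiftJ k)^[k] p) ⟨k - 1, Nat.sub_lt hk one_pos⟩ = p.1) :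
    ∀ (y : E) (η : Fin k → E) (i : ℕ) (hi : i < k),
      K (y, η) ⟨i, hi⟩
        = η ⟨i, hi⟩
          + (∑ j : Fin i,
              K (η ⟨i - 1 - (j : ℕ), Nat.lt_of_le_of_lt
                    ((Nat.sub_le _ _).trans (Nat.sub_le _ _)) hi⟩, 0)
                ⟨(j : ℕ), Nat.lt_trans j.isLt hi⟩)
          + K (y, 0) ⟨i, hi⟩ := by
  intro y η i hi
  have hsplit (y : E) (η : Fin k → E) (i : Fin k) :
      K (y, η) i = K (0, η) i + K (y, 0) i := by
    rw [← Pi.add_apply, ← map_add, Prod.mk_add_mk, zero_add, add_zero]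
  induction i generalizing y η with
  | zero =>
    have h0 : K (0, η) ⟨0, hi⟩ = η ⟨0, hi⟩ := by
      rw [apply_zero_eq_apply_shiftJ_iterate K hshift (k - 1) (Nat.sub_lt hk one_pos),
        ← shiftJ_shift_left hi η, ← Function.iterate_succ_apply]
      simpa only [Nat.succ_eq_add_one, Nat.sub_add_cancel hk] using htop _
    rw [hsplit, h0]
    simp
  | succ i ih =>
    rw [hsplit, ← shiftJ_shift_left hk η, ← hshift i hi, ih,
      Fin.sum_univ_castSucc]
    have hsum (j : Fin i) : i - 1 - (j : ℕ) + 1 = i - j := by omega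
    have hlt (j : Fin i) : i - (j : ℕ) < k := by omega
    simp [hi, hsum, hlt, add_assoc]
end

section
/- Let E be a real Banach space, U, V ⊆ E open, and ψ : U → V a C^∞ diffeomorphism. Let Γ_U : U × E → L(E,E) and Γ_V : V × E → L(E,E) be smooth maps satisfying the transformation law of local components of a linear connection: for all x ∈ U and ξ, y ∈ E, Γ_V(ψ(x), dψ(x)ξ)(dψ(x)y) = dψ(x)(Γ_U(x, ξ)y) − d²ψ(x)(ξ, y), where dψ(x) and d²ψ(x) are the first and second Fréchet derivatives of ψ at x. Then for every smooth curve γ : ℝ → U with γ(0) = x, setting δ := ψ ∘ γ, one has (1/2)[δ''(0) + Γ_V(δ(0), δ'(0))(δ'(0))] = dψ(x)( (1/2)[γ''(0) + Γ_U(x, γ'(0))(γ'(0))] ). (This is the order-2 case of the key computation in Theorem 3.4: the connection-corrected second jet coordinate z² transforms linearly under changes of chart, so π₂ : T²M → M becomes a vector bundle when M carries a linear connection.) -/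
/-- The second derivative of `f` along a curve `γ`. -/
theorem iteratedDeriv_two_comp_curve {𝕜 E F : Type*} [NontriviallyNormedField 𝕜]
    [NormedAddCommGroup E] [NormedSpace 𝕜 E] [NormedAddCommGroup F] [NormedSpace 𝕜 F]
    {f : E → F} {γ : 𝕜 → E} {t : 𝕜}
    (hf : ContDiffAt 𝕜 2 f (γ t)) (hγ : ContDiffAt 𝕜 2 γ t) :
    iteratedDeriv 2 (f ∘ γ) t =
      iteratedFDeriv 𝕜 2 f (γ t) ![deriv γ t, deriv γ t]
        + fderiv 𝕜 f (γ t) (iteratedDeriv 2 γ t) := by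
  have hderiv : deriv (f ∘ γ) =ᶠ[nhds t] fun s => fderiv 𝕜 f (γ s) (deriv γ s) := by
    filter_upwards [hγ.continuousAt.eventually (hf.eventually (by simp)),
      hγ.eventually (by simp)] with s hfs hγs
    exact fderiv_comp_deriv s (hfs.differentiableAt (by simp)) (hγs.differentiableAt (by simp))
  have hγ' : HasDerivAt γ (deriv γ t) t := (hγ.differentiableAt (by simp)).hasDerivAt
  have hγ'' : HasDerivAt (deriv γ) (deriv (deriv γ) t) t := by
    have h : ContDiffAt 𝕜 1 (fun s => fderiv 𝕜 γ s 1) t :=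
      (hγ.fderiv_right (m := 1) (by norm_num)).clm_apply contDiffAt_const
    exact (h.differentiableAt (by simp)).hasDerivAt
  have hf' : HasFDerivAt (fderiv 𝕜 f) (fderiv 𝕜 (fderiv 𝕜 f) (γ t)) (γ t) :=
    ((hf.fderiv_right (m := 1) (by norm_num)).differentiableAt (by simp)).hasFDerivAt
  rw [iteratedDeriv_succ, iteratedDeriv_one, hderiv.deriv_eq, iteratedDeriv_succ,
    iteratedDeriv_one, iteratedFDeriv_two_apply]
  exact ((hf'.comp_hasDerivAt t hγ').clm_apply hγ'').deriv


/-- **Order-2 case of the key computation of Theorem 3.4.**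
If the local components `Γ_U`, `Γ_V` of a linear connection satisfy the
transformation law
`Γ_V(ψ(x), dψ(x)ξ)(dψ(x)y) = dψ(x)(Γ_U(x,ξ)y) − d²ψ(x)(ξ,y)`
under a chart change `ψ`, then the connection-corrected second jet coordinate
`z² = (1/2)(γ''(0) + Γ(x, γ'(0))γ'(0))` transforms linearly:
`(1/2)[δ''(0) + Γ_V(δ(0), δ'(0))δ'(0)] = dψ(x)((1/2)[γ''(0) + Γ_U(x, γ'(0))γ'(0)])`
for `δ = ψ ∘ γ`. -/
theorem second_jet_coordinate_transforms_linearly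
    {E : Type*} [NormedAddCommGroup E] [NormedSpace ℝ E] [CompleteSpace E]
    (U V : Set E) (hU : IsOpen U) (hV : IsOpen V)
    (ψ : E → E) (hψ : ContDiffOn ℝ (⊤ : ℕ∞) ψ U) (hψUV : Set.MapsTo ψ U V)
    (ΓU ΓV : E → E → (E →L[ℝ] E))
    (hΓU : ContDiffOn ℝ (⊤ : ℕ∞) (fun p : E × E => (ΓU p.1 p.2 : E →L[ℝ] E))
      (U ×ˢ (Set.univ : Set E)))
    (hΓV : ContDiffOn ℝ (⊤ : ℕ∞) (fun p : E × E => (ΓV p.1 p.2 : E →L[ℝ] E))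
      (V ×ˢ (Set.univ : Set E)))
    (hlaw : ∀ x ∈ U, ∀ ξ y : E,
      ΓV (ψ x) (fderiv ℝ ψ x ξ) (fderiv ℝ ψ x y)
        = fderiv ℝ ψ x (ΓU x ξ y) - iteratedFDeriv ℝ 2 ψ x ![ξ, y]) :
    ∀ x ∈ U, ∀ γ : ℝ → E, ContDiff ℝ (⊤ : ℕ∞) γ → (∀ t, γ t ∈ U) → γ 0 = x →
      ((1 : ℝ) / 2) • (iteratedDeriv 2 (ψ ∘ γ) 0
          + ΓV (ψ (γ 0)) (deriv (ψ ∘ γ) 0) (deriv (ψ ∘ γ) 0))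
        = fderiv ℝ ψ x
            (((1 : ℝ) / 2) • (iteratedDeriv 2 γ 0 + ΓU x (deriv γ 0) (deriv γ 0))) := by
  rintro x hx γ hγ - rfl
  have hψx : ContDiffAt ℝ 2 ψ (γ 0) :=
    (hψ.contDiffAt (hU.mem_nhds hx)).of_le (WithTop.coe_le_coe.2 (le_top : (2 : ℕ∞) ≤ ⊤))
  have hγ0 : ContDiffAt ℝ 2 γ 0 := hγ.contDiffAt.of_le (WithTop.coe_le_coe.2 (le_top : (2 : ℕ∞) ≤ ⊤))
  rw [iteratedDeriv_two_comp_curve hψx hγ0,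
    fderiv_comp_deriv 0 (hψx.differentiableAt (by simp)) (hγ0.differentiableAt (by simp)),
    hlaw _ hx, map_smul, map_add]
  congr 1
  abel
end

section
/- Let E be a real Banach space, U, V ⊆ E open, ψ : U → V a C^∞ map, and k ≥ 1. For 0 ≤ i ≤ k let F_i^ψ(x,ξ) denote the i-th k-jet component of ψ, F_0^ψ(x,ξ) := ψ(x) and F_i^ψ(x,ξ) := (1/i!)·(dⁱ/dtⁱ)|_{t=0} ψ(x + Σ_j tʲ ξ_j). Let M_U^j : U × E^j → L(E,E) and M_V^j : V × E^j → L(E,E), 1 ≤ j ≤ k, be smooth families satisfying the compatibility condition: for every (x,ξ) ∈ U × E^k, every (y,η) ∈ E × E^k and every 1 ≤ i ≤ k, dψ(x)[η_i + Σ_{j=1}^{i−1} M_U^j(x, ξ₁,…,ξ_j)(η_{i−j}) + M_U^i(x, ξ₁,…,ξ_i)(y)] = η̄_i + Σ_{j=1}^{i−1} M_V^j(F_0^ψ(x,ξ),…,F_j^ψ(x,ξ))(η̄_{i−j}) + M_V^i(F_0^ψ(x,ξ),…,F_i^ψ(x,ξ))(dψ(x)y), where η̄_l denotes the Fréchet derivative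 of F_l^ψ at (x,ξ) applied to the direction (y, η₁, …, η_k). Define z_U^i(x,ζ) := ζ_i + (1/i) Σ_{j=1}^{i−1} (i−j)·M_U^j(x, ζ₁,…,ζ_j)(ζ_{i−j}) for (x,ζ) ∈ U × E^k, and z_V^i analogously on V × E^k. Then for every (x,ζ) ∈ U × E^k and every 1 ≤ i ≤ k: z_V^i(F_0^ψ(x,ζ), F_1^ψ(x,ζ), …, F_k^ψ(x,ζ)) = dψ(x)( z_U^i(x,ζ) ). (This is the core of Theorem 3.4: the connection-corrected jet coordinates z^i transform linearly under chart changes, so that the trivializations Φ_α^k give π_k : T^kM → M a vector bundle structure with structure group GL(E^k), isomorphic to ⊕_{i=1}^k TM.) -/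
/-- The `i`-th `k`-jet component of a map `ψ`, as a function of `p = (x, ξ) ∈ E × E^k`:
`F_i^ψ(x,ξ) = (1/i!) (dⁱ/dtⁱ)|_{t=0} ψ (x + ∑_{j=1}^k t^j ξ_j)`  (so `F_0^ψ(x,ξ) = ψ x`). -/
noncomputable def jetF {E : Type*} [NormedAddCommGroup E] [NormedSpace ℝ E]
    (k : ℕ) (ψ : E → E) (i : ℕ) (p : E × (Fin k → E)) : E :=
  ((1 : ℝ) / (i.factorial : ℝ)) •
    iteratedDeriv i (fun t : ℝ => ψ (p.1 + ∑ j : Fin k, t ^ ((j : ℕ) + 1) • p.2 j)) 0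

/-- Iterated derivatives in a real variable of a smooth map depend smoothly on parameters. -/
theorem contDiffOn_iteratedDeriv_param {P F : Type*} [NormedAddCommGroup P] [NormedSpace ℝ P]
    [NormedAddCommGroup F] [NormedSpace ℝ F] {G : P × ℝ → F} {Ω : Set (P × ℝ)} (hΩ : IsOpen Ω)
    (hG : ContDiffOn ℝ (⊤ : ℕ∞) G Ω) (n : ℕ) :
    ContDiffOn ℝ (⊤ : ℕ∞) (fun q : P × ℝ => iteratedDeriv n (fun t => G (q.1, t)) q.2) Ω := by
  induction n with
  | zero => simpa [iteratedDeriv_zero] using hG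
  | succ n ih =>
    have hfd := ih.fderiv_of_isOpen (m := (⊤ : ℕ∞)) hΩ (by simp)
    refine (hfd.clm_apply (contDiffOn_const (c := ((0 : P), (1 : ℝ))))).congr ?_
    rintro ⟨p, t⟩ hq
    have hd := ((ih.contDiffAt (hΩ.mem_nhds hq)).differentiableAt (by simp)).hasFDerivAt
    have hline : HasDerivAt (fun s : ℝ => (p, s)) ((0 : P), (1 : ℝ)) t :=
      (hasDerivAt_const t p).prodMk (hasDerivAt_id t)
    rw [iteratedDeriv_succ]
    exact (hd.comp_hasDerivAt t hline).deriv

/-- Iterated derivatives of a map precomposed with a homothety, without smoothness assumptions. -/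
theorem iteratedDeriv_comp_mul_left_eq {F : Type*} [NormedAddCommGroup F] [NormedSpace ℝ F]
    (f : ℝ → F) (c : ℝ) (n : ℕ) :
    iteratedDeriv n (fun t => f (c * t)) = fun t => c ^ n • iteratedDeriv n f (c * t) := by
  induction n with
  | zero => simp [iteratedDeriv_zero]
  | succ n ih =>
    funext t
    rw [iteratedDeriv_succ, ih, deriv_fun_const_smul_field, deriv_comp_mul_left, iteratedDeriv_succ,
      smul_smul, pow_succ]

section

variable {E : Type*} [NormedAddCommGroup E] [NormedSpace ℝ E]

theorem differentiableAt_jetF {U : Set E} (hU : IsOpen U) {ψ : E → E}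
    (hψ : ContDiffOn ℝ (⊤ : ℕ∞) ψ U) (k i : ℕ) {x : E} (hx : x ∈ U) (ξ : Fin k → E) :
    DifferentiableAt ℝ (jetF k ψ i) (x, ξ) := by
  have hc : ContDiff ℝ (⊤ : ℕ∞) (fun q : (E × (Fin k → E)) × ℝ =>
      q.1.1 + ∑ j : Fin k, q.2 ^ ((j : ℕ) + 1) • q.1.2 j) := by
    fun_prop
  have hmem : ((x, ξ), (0 : ℝ)) ∈ (fun q : (E × (Fin k → E)) × ℝ =>
      q.1.1 + ∑ j : Fin k, q.2 ^ ((j : ℕ) + 1) • q.1.2 j) ⁻¹' U := by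
    simpa using hx
  have hΩ := hU.preimage hc.continuous
  have h := contDiffOn_iteratedDeriv_param hΩ
    (hψ.comp hc.contDiffOn (Set.mapsTo_preimage _ _)) i
  have hd := (h.contDiffAt (hΩ.mem_nhds hmem)).differentiableAt (by simp)
  have hin : DifferentiableAt ℝ (fun p : E × (Fin k → E) => (p, (0 : ℝ))) (x, ξ) := by
    fun_prop
  exact (DifferentiableAt.comp (x, ξ) hd hin).const_smul ((1 : ℝ) / (i.factorial : ℝ))

/-- Jet components are homogeneous under reparametrization of the curve by a homothety. -/
theorem jetF_homothety (k : ℕ) (ψ : E → E) (i : ℕ) (x : E) (ξ : Fin k → E) (c : ℝ) :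
    jetF k ψ i (x, fun j => c ^ ((j : ℕ) + 1) • ξ j) = c ^ i • jetF k ψ i (x, ξ) := by
  have h := congrFun (iteratedDeriv_comp_mul_left_eq
    (fun t : ℝ => ψ (x + ∑ j : Fin k, t ^ ((j : ℕ) + 1) • ξ j)) c i) 0
  simp only [mul_zero] at h
  simp only [jetF]
  rw [smul_comm, ← h]
  simp only [smul_smul, mul_pow, mul_comm]

/-- Euler's identity for jet components. -/
theorem fderiv_jetF_euler {U : Set E} (hU : IsOpen U) {ψ : E → E}
    (hψ : ContDiffOn ℝ (⊤ : ℕ∞) ψ U) (k i : ℕ) {x : E} (hx : x ∈ U) (ξ : Fin k → E) :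
    fderiv ℝ (jetF k ψ i) (x, ξ) (0, fun j => (((j : ℕ) + 1 : ℕ) : ℝ) • ξ j)
      = (i : ℝ) • jetF k ψ i (x, ξ) := by
  have hcurve : HasDerivAt (fun c : ℝ => (x, fun j : Fin k => c ^ ((j : ℕ) + 1) • ξ j))
      ((0 : E), fun j : Fin k => (((j : ℕ) + 1 : ℕ) : ℝ) • ξ j) 1 := by
    refine (hasDerivAt_const (1 : ℝ) x).prodMk (hasDerivAt_pi.2 fun j => ?_)
    simpa using (hasDerivAt_pow ((j : ℕ) + 1) (1 : ℝ)).smul_const (ξ j)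
  have hd : HasFDerivAt (jetF k ψ i) (fderiv ℝ (jetF k ψ i) (x, ξ))
      (x, fun j : Fin k => (1 : ℝ) ^ ((j : ℕ) + 1) • ξ j) := by
    simpa using (differentiableAt_jetF hU hψ k i hx ξ).hasFDerivAt
  have h1 := hd.comp_hasDerivAt (1 : ℝ) hcurve
  have h2 : HasDerivAt (fun c : ℝ => c ^ i • jetF k ψ i (x, ξ)) ((i : ℝ) • jetF k ψ i (x, ξ)) 1 := by
    simpa using (hasDerivAt_pow i (1 : ℝ)).smul_const (jetF k ψ i (x, ξ))
  refine h1.unique (h2.congr_of_eventuallyEq (Filter.Eventually.of_forall fun c => ?_))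
  exact jetF_homothety k ψ i x ξ c

end

/-- **Core of Theorem 3.4.** If the local components `M_U^j`, `M_V^j` of a connection
map on `T^k M` satisfy the compatibility condition (equation (5) of the paper) under a
chart change `ψ`, then the connection-corrected jet coordinates
`z^i(x,ζ) = ζ_i + (1/i) ∑_{j=1}^{i−1} (i−j) M^j(x, ζ₁,…,ζ_j)(ζ_{i−j})`
transform linearly: `z_V^i(F_0^ψ(x,ζ), …, F_k^ψ(x,ζ)) = dψ(x)(z_U^i(x,ζ))`.
(Here `η̄_l` of the paper is the Fréchet derivative of `F_l^ψ` at `(x,ξ)` in the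
direction `(y,η)`; a 1-indexed tuple entry `ζ_l` is `ζ ⟨l-1, _⟩`.) -/
theorem corrected_jet_coordinates_transform_linearly
    {E : Type*} [NormedAddCommGroup E] [NormedSpace ℝ E] [CompleteSpace E]
    (U V : Set E) (hU : IsOpen U) (hV : IsOpen V)
    (ψ : E → E) (hψ : ContDiffOn ℝ (⊤ : ℕ∞) ψ U) (hψUV : Set.MapsTo ψ U V)
    (k : ℕ) (hk : 1 ≤ k)
    (MU MV : (j : ℕ) → E → (Fin j → E) → (E →L[ℝ] E))
    (hMU : ∀ j, 1 ≤ j → j ≤ k →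
      ContDiffOn ℝ (⊤ : ℕ∞) (fun q : E × (Fin j → E) => (MU j q.1 q.2 : E →L[ℝ] E))
        (U ×ˢ (Set.univ : Set (Fin j → E))))
    (hMV : ∀ j, 1 ≤ j → j ≤ k →
      ContDiffOn ℝ (⊤ : ℕ∞) (fun q : E × (Fin j → E) => (MV j q.1 q.2 : E →L[ℝ] E))
        (V ×ˢ (Set.univ : Set (Fin j → E))))
    (compat : ∀ x ∈ U, ∀ ξ η : Fin k → E, ∀ y : E,
      ∀ i, ∀ hi1 : 1 ≤ i, ∀ hik : i ≤ k,
      fderiv ℝ ψ x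
          (η ⟨i - 1, by omega⟩
            + (∑ j ∈ Finset.univ.filter (fun j : Fin k => 1 ≤ (j : ℕ) ∧ (j : ℕ) ≤ i - 1),
                MU (j : ℕ) x (fun r : Fin (j : ℕ) => ξ (Fin.castLE j.isLt.le r))
                  (η ⟨i - (j : ℕ) - 1, by omega⟩))
            + MU i x (fun r : Fin i => ξ (Fin.castLE hik r)) y)
        = fderiv ℝ (jetF k ψ i) (x, ξ) (y, η)
            + (∑ j ∈ Finset.univ.filter (fun j : Fin k => 1 ≤ (j : ℕ) ∧ (j : ℕ) ≤ i - 1),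
                MV (j : ℕ) (ψ x) (fun r : Fin (j : ℕ) => jetF k ψ ((r : ℕ) + 1) (x, ξ))
                  (fderiv ℝ (jetF k ψ (i - (j : ℕ))) (x, ξ) (y, η)))
            + MV i (ψ x) (fun r : Fin i => jetF k ψ ((r : ℕ) + 1) (x, ξ))
                (fderiv ℝ ψ x y)) :
    ∀ x ∈ U, ∀ ζ : Fin k → E, ∀ i, ∀ hi1 : 1 ≤ i, ∀ hik : i ≤ k,
      jetF k ψ i (x, ζ)
          + ((1 : ℝ) / (i : ℝ)) •
            (∑ j ∈ Finset.univ.filter (fun j : Fin k => 1 ≤ (j : ℕ) ∧ (j : ℕ) ≤ i - 1),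
              ((i - (j : ℕ) : ℕ) : ℝ) •
                MV (j : ℕ) (ψ x) (fun r : Fin (j : ℕ) => jetF k ψ ((r : ℕ) + 1) (x, ζ))
                  (jetF k ψ (i - (j : ℕ)) (x, ζ)))
        = fderiv ℝ ψ x
            (ζ ⟨i - 1, by omega⟩
              + ((1 : ℝ) / (i : ℝ)) •
                (∑ j ∈ Finset.univ.filter (fun j : Fin k => 1 ≤ (j : ℕ) ∧ (j : ℕ) ≤ i - 1),
                  ((i - (j : ℕ) : ℕ) : ℝ) •
                    MU (j : ℕ) x (fun r : Fin (j : ℕ) => ζ (Fin.castLE j.isLt.le r))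
                      (ζ ⟨i - (j : ℕ) - 1, by omega⟩))) := by
  intro x hx ζ i hi1 hik
  have h := compat x hx ζ (fun j => (((j : ℕ) + 1 : ℕ) : ℝ) • ζ j) 0 i hi1 hik
  simp only [fderiv_jetF_euler hU hψ k _ hx ζ, map_zero, add_zero, map_smul] at h
  have hi0 : (i : ℝ) ≠ 0 := by
    exact_mod_cast (by omega : i ≠ 0)
  have hsum : ∀ j ∈ Finset.univ.filter (fun j : Fin k => 1 ≤ (j : ℕ) ∧ (j : ℕ) ≤ i - 1),
      ((i - (j : ℕ) - 1 + 1 : ℕ) : ℝ) •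
          MU (j : ℕ) x (fun r : Fin (j : ℕ) => ζ (Fin.castLE j.isLt.le r))
            (ζ ⟨i - (j : ℕ) - 1, by omega⟩)
        = ((i - (j : ℕ) : ℕ) : ℝ) •
          MU (j : ℕ) x (fun r : Fin (j : ℕ) => ζ (Fin.castLE j.isLt.le r))
            (ζ ⟨i - (j : ℕ) - 1, by omega⟩) := by
    intro j hj
    obtain ⟨-, -, hj2⟩ := Finset.mem_filter.1 hj
    rw [show i - (j : ℕ) - 1 + 1 = i - (j : ℕ) by omega]
  rw [Finset.sum_congr rfl hsum, Nat.sub_add_cancel hi1] at h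
  have h' := congrArg (fun v => ((1 : ℝ) / (i : ℝ)) • v) h
  simp only [map_add, map_smul, smul_add, smul_smul, one_div, inv_mul_cancel₀ hi0, one_smul] at h'
  simp only [map_add, map_smul, one_div]
  exact h'.symm
end

section
/- Let E and F be real Banach spaces, U ⊆ E open, ψ : U → F a C^∞ map, i ≥ 2, x ∈ U and v₁, …, v_i ∈ E. Define γ̄(t) := x + Σ_{l=1}^{i} (tˡ/l!) v_l and c̄(t,s) := x + s v₁ + Σ_{l=1}^{i−1} (tˡ/l!)(v_l + s v_{l+1}). Then: (a) for every 1 ≤ l ≤ i, the mixed partial derivative ∂_s ∂_t^{l−1} (ψ ∘ c̄)(0,0) equals the l-th derivative (ψ ∘ γ̄)⁽ˡ⁾(0); and (b) for every 1 ≤ l ≤ i−1, ∂_t^{l} (ψ ∘ c̄)(0,0) = (ψ ∘ γ̄)⁽ˡ⁾(0). (These are the auxiliary identities used in Step 2 of the proof of Theorem 3.4.) -/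
open scoped ContDiff Topology
open Filter

/-- The `t`-derivatives at `0` and the `s`-derivative at `0` of a smooth function commute. -/
theorem deriv_iteratedDeriv_comm {F : Type*} [NormedAddCommGroup F] [NormedSpace ℝ F] (n : ℕ)
    (G : ℝ × ℝ → F) (hG : ∀ᶠ p in 𝓝 (0 : ℝ × ℝ), ContDiffAt ℝ ∞ G p) :
    deriv (fun s : ℝ => iteratedDeriv n (fun t : ℝ => G (t, s)) 0) 0
      = iteratedDeriv n (fun t : ℝ => deriv (fun s : ℝ => G (t, s)) 0) 0 := by
  induction n generalizing G with
  | zero => simp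
  | succ n ih =>
    have fst_deriv {H : ℝ × ℝ → F} {p : ℝ × ℝ} (hH : DifferentiableAt ℝ H p) :
        deriv (fun t => H (t, p.2)) p.1 = fderiv ℝ H p (1, 0) :=
      (HasFDerivAt.comp_hasDerivAt (f := fun t => (t, p.2)) p.1 hH.hasFDerivAt
        ((hasDerivAt_id p.1).prodMk (hasDerivAt_const p.1 p.2))).deriv
    have snd_deriv {H : ℝ × ℝ → F} {p : ℝ × ℝ} (hH : DifferentiableAt ℝ H p) :
        deriv (fun s => H (p.1, s)) p.2 = fderiv ℝ H p (0, 1) :=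
      (HasFDerivAt.comp_hasDerivAt (f := fun s => (p.1, s)) p.2 hH.hasFDerivAt
        ((hasDerivAt_const p.2 p.1).prodMk (hasDerivAt_id p.2))).deriv
    have hfderiv : ∀ᶠ p in 𝓝 (0 : ℝ × ℝ), ContDiffAt ℝ ∞ (fderiv ℝ G) p := by
      filter_upwards [hG] with p hp using hp.fderiv_right (by simp)
    have tendsto_fst : Tendsto (fun t : ℝ => (t, (0 : ℝ))) (𝓝 0) (𝓝 (0 : ℝ × ℝ)) :=
      (Continuous.prodMk_left (0 : ℝ)).tendsto' _ _ rfl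
    have tendsto_snd : Tendsto (fun s : ℝ => ((0 : ℝ), s)) (𝓝 0) (𝓝 (0 : ℝ × ℝ)) :=
      (Continuous.prodMk_right (0 : ℝ)).tendsto' _ _ rfl
    have hleft : (fun s : ℝ => iteratedDeriv (n + 1) (fun t : ℝ => G (t, s)) 0) =ᶠ[𝓝 0]
        fun s => iteratedDeriv n (fun t : ℝ => fderiv ℝ G (t, s) (1, 0)) 0 := by
      filter_upwards [tendsto_snd.eventually hG.eventually_nhds] with s hs
      rw [iteratedDeriv_succ']
      refine (EventuallyEq.iteratedDeriv ?_ n).eq_of_nhds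
      have := (Continuous.prodMk_left s).tendsto (0 : ℝ)
      filter_upwards [this.eventually hs] with t ht
      exact fst_deriv (p := (t, s)) (ht.differentiableAt (by simp))
    rw [hleft.deriv_eq, ih (fun p => fderiv ℝ G p (1, 0)), iteratedDeriv_succ']
    · refine (EventuallyEq.iteratedDeriv ?_ n).eq_of_nhds
      filter_upwards [tendsto_fst.eventually hG, tendsto_fst.eventually hfderiv,
        (tendsto_fst.eventually hG).eventually_nhds] with t ht ht' hnear
      have hd : DifferentiableAt ℝ (fderiv ℝ G) (t, 0) := ht'.differentiableAt (by simp)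
      have happly (a b : ℝ × ℝ) : fderiv ℝ (fun p => fderiv ℝ G p a) (t, 0) b
          = fderiv ℝ (fderiv ℝ G) (t, 0) b a := by
        rw [(hd.hasFDerivAt.clm_apply (hasFDerivAt_const a _)).fderiv]
        simp
      have hsymm : IsSymmSndFDerivAt ℝ G (t, 0) := by
        refine ht.isSymmSndFDerivAt ?_
        rw [minSmoothness_of_isRCLikeNormedField]
        exact WithTop.coe_le_coe.2 le_top
      have hright : (fun t : ℝ => deriv (fun s : ℝ => G (t, s)) 0) =ᶠ[𝓝 t]
          fun t => fderiv ℝ G (t, 0) (0, 1) := by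
        filter_upwards [hnear] with u hu
        exact snd_deriv (p := (u, 0)) (hu.differentiableAt (by simp))
      rw [hright.deriv_eq,
        fst_deriv (H := fun p => fderiv ℝ G p (0, 1)) (p := (t, 0))
          (hd.clm_apply (differentiableAt_const _)),
        snd_deriv (H := fun p => fderiv ℝ G p (1, 0)) (p := (t, 0))
          (hd.clm_apply (differentiableAt_const _)), happly, happly]
      exact hsymm _ _
    · filter_upwards [hfderiv] with p hp using hp.clm_apply contDiffAt_const

/-- Perturbing a curve by a term `t ^ m • w` does not change the derivatives of order `< m` at `0`
of its composition with a smooth map. -/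
theorem iteratedDeriv_comp_add_pow_smul {E F : Type*} [NormedAddCommGroup E] [NormedSpace ℝ E]
    [NormedAddCommGroup F] [NormedSpace ℝ F] {Φ : E → F} {f : ℝ → E} {k m : ℕ} (hk : k < m)
    (hf : ContDiffAt ℝ ∞ f 0) (hΦ : ContDiffAt ℝ ∞ Φ (f 0)) (w : E) :
    iteratedDeriv k (fun t => Φ (f t + t ^ m • w)) 0 = iteratedDeriv k (fun t => Φ (f t)) 0 := by
  have hm : m ≠ 0 := by omega
  have hpow : ContDiff ℝ ∞ (fun t : ℝ => t ^ m) := contDiff_id.pow m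
  have hsmul : ContDiff ℝ ∞ (fun t : ℝ => t ^ m • w) := hpow.smul contDiff_const
  have hk' : (k : ℕ∞ω) ≤ ∞ := by exact_mod_cast le_top
  have h0 : f 0 + (0 : ℝ) ^ m • w = f 0 := by simp [hm]
  have hjet (j : ℕ) (hj : j ≤ k) :
      iteratedDeriv j (fun t => f t + t ^ m • w) 0 = iteratedDeriv j f 0 := by
    have hj' : (j : ℕ∞ω) ≤ ∞ := by exact_mod_cast le_top
    rw [iteratedDeriv_fun_add (hf.of_le hj') (hsmul.contDiffAt.of_le hj'),
      iteratedDeriv_smul_const (hpow.contDiffAt.of_le hj'), iteratedDeriv_fun_pow_zero,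
      if_neg (by omega)]
    simp
  have hg := iteratedDeriv_vcomp_eq_sum_orderedFinpartition (g := Φ)
    (f := fun t => f t + t ^ m • w) (by rwa [h0]) (hf.add hsmul.contDiffAt) hk'
  refine hg.trans ((Finset.sum_congr rfl fun c _ => ?_).trans
    (iteratedDeriv_vcomp_eq_sum_orderedFinpartition hΦ hf hk').symm)
  rw [h0]
  congr 1
  ext j
  exact hjet _ (c.partSize_le j)

theorem hasDerivAt_sum_pow_div_factorial_smul {E : Type*} [NormedAddCommGroup E] [NormedSpace ℝ E]
    (v : ℕ → E) (m : ℕ) (t : ℝ) :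
    HasDerivAt (fun t : ℝ => ∑ l ∈ Finset.Icc 1 (m + 1), (t ^ l / (l.factorial : ℝ)) • v l)
      (v 1 + ∑ l ∈ Finset.Icc 1 m, (t ^ l / (l.factorial : ℝ)) • v (l + 1)) t := by
  induction m with
  | zero => simpa using (hasDerivAt_id t).smul_const (v 1)
  | succ m ih =>
    simp only [Finset.sum_Icc_succ_top (show 1 ≤ m + 1 + 1 by omega)]
    rw [Finset.sum_Icc_succ_top (by omega), ← add_assoc]
    refine ih.add ?_
    have hpow := ((hasDerivAt_pow (m + 1 + 1) t).div_const
      ((m + 1 + 1).factorial : ℝ)).smul_const (v (m + 1 + 1))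
    convert hpow using 2
    rw [Nat.factorial_succ (m + 1)]
    have : ((m + 1).factorial : ℝ) ≠ 0 := by positivity
    push_cast
    field_simp


/-- **Auxiliary identities of Step 2 of the proof of Theorem 3.4.**
With `γ̄(t) = x + ∑_{l=1}^i (tˡ/l!) v_l` and
`c̄(t,s) = x + s v₁ + ∑_{l=1}^{i−1} (tˡ/l!)(v_l + s v_{l+1})`, one has
(a) `∂_s ∂_t^{l−1} (ψ ∘ c̄)(0,0) = (ψ ∘ γ̄)⁽ˡ⁾(0)` for `1 ≤ l ≤ i`, and
(b) `∂_t^{l} (ψ ∘ c̄)(0,0) = (ψ ∘ γ̄)⁽ˡ⁾(0)` for `1 ≤ l ≤ i−1`. -/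
theorem mixed_partials_of_double_curve
    {E F : Type*} [NormedAddCommGroup E] [NormedSpace ℝ E] [CompleteSpace E]
    [NormedAddCommGroup F] [NormedSpace ℝ F] [CompleteSpace F]
    (U : Set E) (hU : IsOpen U) (ψ : E → F) (hψ : ContDiffOn ℝ (⊤ : ℕ∞) ψ U)
    (i : ℕ) (hi : 2 ≤ i) (x : E) (hx : x ∈ U) (v : ℕ → E)
    (cbar : ℝ → ℝ → E)
    (hcbar : ∀ t s : ℝ, cbar t s
      = x + s • v 1 + ∑ l ∈ Finset.Icc 1 (i - 1),
          ((t ^ l / (l.factorial : ℝ)) • (v l + s • v (l + 1))))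
    (γbar : ℝ → E)
    (hγbar : ∀ t : ℝ, γbar t
      = x + ∑ l ∈ Finset.Icc 1 i, ((t ^ l / (l.factorial : ℝ)) • v l))
    (hmem : ∀ᶠ p : ℝ × ℝ in nhds (0, 0), cbar p.1 p.2 ∈ U) :
    (∀ l, 1 ≤ l → l ≤ i →
      deriv (fun s : ℝ => iteratedDeriv (l - 1) (fun t : ℝ => ψ (cbar t s)) 0) 0
        = iteratedDeriv l (fun t : ℝ => ψ (γbar t)) 0) ∧
    (∀ l, 1 ≤ l → l ≤ i - 1 →
      iteratedDeriv l (fun t : ℝ => ψ (cbar t 0)) 0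
        = iteratedDeriv l (fun t : ℝ => ψ (γbar t)) 0) := by
  obtain ⟨m, rfl⟩ : ∃ m, i = m + 1 := ⟨i - 1, by omega⟩
  simp only [Nat.add_sub_cancel] at hcbar ⊢
  set A : ℝ → E := fun t => x + ∑ l ∈ Finset.Icc 1 m, (t ^ l / (l.factorial : ℝ)) • v l with hA
  set B : ℝ → E :=
    fun t => v 1 + ∑ l ∈ Finset.Icc 1 m, (t ^ l / (l.factorial : ℝ)) • v (l + 1) with hB
  set w : E := (1 / ((m + 1).factorial : ℝ)) • v (m + 1) with hw
  have hc (t s : ℝ) : cbar t s = A t + s • B t := by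
    simp only [hcbar, hA, hB, smul_add, Finset.sum_add_distrib, Finset.smul_sum,
      smul_comm s (_ : ℝ)]
    abel
  have hγ (t : ℝ) : γbar t = A t + t ^ (m + 1) • w := by
    rw [hγbar, Finset.sum_Icc_succ_top (by omega), hw, smul_smul, mul_one_div, ← add_assoc]
  have hγ' (t : ℝ) : HasDerivAt γbar (B t) t := by
    rw [funext hγbar]
    exact (hasDerivAt_sum_pow_div_factorial_smul v m t).const_add x
  have hsmooth (u : ℕ → E) :
      ContDiff ℝ ∞ fun t : ℝ => ∑ l ∈ Finset.Icc 1 m, (t ^ l / (l.factorial : ℝ)) • u l :=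
    ContDiff.sum fun l _ => ((contDiff_id.pow l).div_const _).smul contDiff_const
  have hAs : ContDiff ℝ ∞ A := contDiff_const.add (hsmooth v)
  have hBs : ContDiff ℝ ∞ B := contDiff_const.add (hsmooth fun l => v (l + 1))
  have hA0 : A 0 = x := by
    rw [hA]
    simp only [add_eq_left]
    refine Finset.sum_eq_zero fun l hl => ?_
    have : l ≠ 0 := by have := (Finset.mem_Icc.1 hl).1; omega
    simp [this]
  have hψat {y : E} (hy : y ∈ U) : ContDiffAt ℝ ∞ ψ y := hψ.contDiffAt (hU.mem_nhds hy)
  have hAU : ∀ᶠ t in 𝓝 (0 : ℝ), A t ∈ U :=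
    hAs.continuous.continuousAt.eventually_mem (hU.mem_nhds (by rwa [hA0]))
  have hγU : ∀ᶠ t in 𝓝 (0 : ℝ), γbar t ∈ U :=
    (hγ' 0).continuousAt.eventually_mem (hU.mem_nhds (by rw [hγ, hA0]; simpa using hx))
  have hψA : ContDiffAt ℝ ∞ ψ (A 0) := hψat (by rwa [hA0])
  refine ⟨fun l hl hlm => ?_, fun l hl hlm => ?_⟩
  · obtain ⟨k, rfl⟩ : ∃ k, l = k + 1 := ⟨l - 1, by omega⟩
    have hG : ∀ᶠ p in 𝓝 (0 : ℝ × ℝ), ContDiffAt ℝ ∞ (fun p : ℝ × ℝ => ψ (cbar p.1 p.2)) p := by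
      filter_upwards [hmem] with p hp
      have hcs : ContDiff ℝ ∞ fun p : ℝ × ℝ => cbar p.1 p.2 := by
        simp only [hc]
        exact (hAs.comp contDiff_fst).add (contDiff_snd.smul (hBs.comp contDiff_fst))
      exact ContDiffAt.comp (g := ψ) p (hψat hp) hcs.contDiffAt
    have hleft : (fun t => deriv (fun s => ψ (cbar t s)) 0) =ᶠ[𝓝 0]
        fun t => fderiv ℝ ψ (A t) (B t) := by
      filter_upwards [hAU] with t ht
      simp only [hc]
      have hline : HasDerivAt (fun s : ℝ => A t + s • B t) (B t) 0 := by
        simpa using ((hasDerivAt_id (0 : ℝ)).smul_const (B t)).const_add (A t)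
      have hd : HasFDerivAt ψ (fderiv ℝ ψ (A t)) (A t + (0 : ℝ) • B t) := by
        simpa using ((hψat ht).differentiableAt (by simp)).hasFDerivAt
      exact (hd.comp_hasDerivAt (0 : ℝ) hline).deriv
    have hright : deriv (fun t => ψ (γbar t)) =ᶠ[𝓝 0]
        fun t => fderiv ℝ ψ (γbar t) (B t) := by
      filter_upwards [hγU] with t ht
      exact (((hψat ht).differentiableAt (by simp)).hasFDerivAt.comp_hasDerivAt t (hγ' t)).deriv
    have hΦ : ContDiffAt ℝ ∞ (fun p : E × E => fderiv ℝ ψ p.1 p.2) (A 0, B 0) :=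
      (ContDiffAt.comp (g := fderiv ℝ ψ) (A 0, B 0) (hψA.fderiv_right (by simp))
        contDiffAt_fst).clm_apply contDiffAt_snd
    rw [Nat.add_sub_cancel, deriv_iteratedDeriv_comm k (fun p => ψ (cbar p.1 p.2)) hG,
      (hleft.iteratedDeriv k).eq_of_nhds, iteratedDeriv_succ',
      (hright.iteratedDeriv k).eq_of_nhds]
    have := iteratedDeriv_comp_add_pow_smul (show k < m + 1 by omega)
      (hAs.prodMk hBs).contDiffAt hΦ (w, 0)
    simpa [hγ] using this.symm
  · simp only [hc, hγ, zero_smul, add_zero]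
    exact (iteratedDeriv_comp_add_pow_smul (by omega) hAs.contDiffAt hψA w).symm
end

section
/- Let E be a real Banach space, U ⊆ E open, and k ≥ 2. Let M^j : U × E^j → L(E,E), 1 ≤ j ≤ k−1, be smooth maps. Define Z : U × E^k → U × E^k by Z(x, ζ₁, …, ζ_k) := (x, z¹, …, z^k), where z¹ := ζ₁ and z^i := ζ_i + (1/i) Σ_{j=1}^{i−1} (i−j)·M^j(x, ζ₁, …, ζ_j)(ζ_{i−j}) for 2 ≤ i ≤ k. Then Z is a bijection of U × E^k onto itself and both Z and Z⁻¹ are C^∞; moreover Z commutes with the projection onto U. (This is the injectivity/surjectivity part of the proof of Theorem 3.4: each trivialization Φ_α^k of T^kM built from the connection components M^j is a bijective fibre-preserving smooth map, with inverse constructed recursively by polynomial curves.) -/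
/-- The iterates `p ↦ (z.1, z.2 - F p)`, started at `z`, that solve `p.2 + F p = z.2` over `z.1`
when `F` is strictly lower triangular. -/
def triangularIterate {E : Type*} [AddGroup E] {k : ℕ} (F : Fin k → E × (Fin k → E) → E)
    (z : E × (Fin k → E)) : ℕ → E × (Fin k → E)
  | 0 => z
  | n + 1 => (z.1, fun i => z.2 i - F i (triangularIterate F z n))

section Algebraic

variable {E : Type*} [AddGroup E] {k : ℕ} {F : Fin k → E × (Fin k → E) → E}

theorem triangularIterate_fst (F : Fin k → E × (Fin k → E) → E) (z : E × (Fin k → E)) (n : ℕ) :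
    (triangularIterate F z n).1 = z.1 := by
  cases n <;> rfl

theorem triangularIterate_apply_eq
    (hF : ∀ i p q, p.1 = q.1 → (∀ r < i, p.2 r = q.2 r) → F i p = F i q)
    (p : E × (Fin k → E)) (n : ℕ) (i : Fin k) (hi : (i : ℕ) < n) :
    (triangularIterate F (p.1, fun i => p.2 i + F i p) n).2 i = p.2 i := by
  induction n generalizing i with
  | zero => omega
  | succ n ih =>
    have h := hF i (triangularIterate F (p.1, fun i => p.2 i + F i p) n) p
      (triangularIterate_fst F _ n) fun r hr => ih r (by omega)
    simp [triangularIterate, h]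

theorem triangularIterate_stable
    (hF : ∀ i p q, p.1 = q.1 → (∀ r < i, p.2 r = q.2 r) → F i p = F i q)
    (z : E × (Fin k → E)) (n : ℕ) (i : Fin k) (hi : (i : ℕ) < n) :
    (triangularIterate F z (n + 1)).2 i = (triangularIterate F z n).2 i := by
  induction n generalizing i with
  | zero => omega
  | succ n ih =>
    have h := hF i (triangularIterate F z (n + 1)) (triangularIterate F z n)
      (by simp only [triangularIterate_fst]) fun r hr => ih r (by omega)
    change z.2 i - F i (triangularIterate F z (n + 1)) = z.2 i - F i (triangularIterate F z n)
    rw [h]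

theorem triangularIterate_leftInverse
    (hF : ∀ i p q, p.1 = q.1 → (∀ r < i, p.2 r = q.2 r) → F i p = F i q)
    (p : E × (Fin k → E)) :
    triangularIterate F (p.1, fun i => p.2 i + F i p) k = p :=
  Prod.ext (triangularIterate_fst F _ k)
    (funext fun i => triangularIterate_apply_eq hF p k i i.isLt)

theorem triangularIterate_rightInverse
    (hF : ∀ i p q, p.1 = q.1 → (∀ r < i, p.2 r = q.2 r) → F i p = F i q)
    (z : E × (Fin k → E)) :
    ((triangularIterate F z k).1,
      fun i => (triangularIterate F z k).2 i + F i (triangularIterate F z k)) = z := by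
  refine Prod.ext (triangularIterate_fst F z k) (funext fun i => ?_)
  change (triangularIterate F z k).2 i + F i (triangularIterate F z k) = z.2 i
  rw [← triangularIterate_stable hF z k i i.isLt]
  exact sub_add_cancel _ _

end Algebraic

theorem contDiffOn_triangularIterate {E : Type*} [NormedAddCommGroup E] [NormedSpace ℝ E] {k : ℕ}
    {F : Fin k → E × (Fin k → E) → E} {U : Set E} {m : WithTop ℕ∞}
    (hF : ∀ i, ContDiffOn ℝ m (F i) (U ×ˢ Set.univ)) (n : ℕ) :
    ContDiffOn ℝ m (fun z => triangularIterate F z n) (U ×ˢ Set.univ) := by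
  induction n with
  | zero => exact contDiffOn_id
  | succ n ih =>
    refine contDiff_fst.contDiffOn.prodMk (contDiffOn_pi.2 fun i => ContDiffOn.sub ?_ ?_)
    · exact ContDiff.contDiffOn (by fun_prop)
    · refine (hF i).comp ih fun z hz => ⟨?_, Set.mem_univ _⟩
      rw [triangularIterate_fst]
      exact hz.1

/-- **The trivialization map of Theorem 3.4 is a smooth fibre-preserving bijection.**
Given smooth connection-map components `M^j : U × E^j → L(E,E)` (`1 ≤ j ≤ k−1`),
the map `Z(x, ζ₁, …, ζ_k) = (x, z¹, …, z^k)` with `z¹ = ζ₁` and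
`z^i = ζ_i + (1/i) ∑_{j=1}^{i−1} (i−j) M^j(x, ζ₁,…,ζ_j)(ζ_{i−j})` for `2 ≤ i ≤ k`
is a bijection of `U × E^k` onto itself, it and its inverse are `C^∞`, and it
commutes with the projection onto `U`.
(Coordinates are 0-based: the Fin-index `i` stands for `ζ_{i+1}` and `z^{i+1}`, so
`z^{i+1} = ζ_{i+1} + (1/(i+1)) ∑_{1 ≤ j ≤ i} (i+1−j) M^j(x, ζ₁,…,ζ_j)(ζ_{i+1−j})`,
the sum being empty for `i = 0`.) -/
theorem connection_trivialization_smooth_bijection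
    {E : Type*} [NormedAddCommGroup E] [NormedSpace ℝ E] [CompleteSpace E]
    (U : Set E) (hU : IsOpen U) (k : ℕ) (hk : 2 ≤ k)
    (M : (j : ℕ) → E → (Fin j → E) → (E →L[ℝ] E))
    (hM : ∀ j, 1 ≤ j → j ≤ k - 1 →
      ContDiffOn ℝ (⊤ : ℕ∞) (fun q : E × (Fin j → E) => (M j q.1 q.2 : E →L[ℝ] E))
        (U ×ˢ (Set.univ : Set (Fin j → E))))
    (Z : E × (Fin k → E) → E × (Fin k → E))
    (hZ : ∀ p : E × (Fin k → E), Z p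
      = (p.1, fun i : Fin k =>
          p.2 i + ((1 : ℝ) / (((i : ℕ) + 1 : ℕ) : ℝ)) •
            ∑ j ∈ Finset.univ.filter (fun j : Fin k => 1 ≤ (j : ℕ) ∧ (j : ℕ) ≤ (i : ℕ)),
              ((((i : ℕ) + 1 - (j : ℕ) : ℕ)) : ℝ) •
                M (j : ℕ) p.1 (fun r : Fin (j : ℕ) => p.2 (Fin.castLE j.isLt.le r))
                  (p.2 ⟨(i : ℕ) - (j : ℕ), Nat.lt_of_le_of_lt (Nat.sub_le _ _) i.isLt⟩))) :
    Set.BijOn Z (U ×ˢ (Set.univ : Set (Fin k → E))) (U ×ˢ (Set.univ : Set (Fin k → E))) ∧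
    ContDiffOn ℝ (⊤ : ℕ∞) Z (U ×ˢ (Set.univ : Set (Fin k → E))) ∧
    (∃ W : E × (Fin k → E) → E × (Fin k → E),
      ContDiffOn ℝ (⊤ : ℕ∞) W (U ×ˢ (Set.univ : Set (Fin k → E))) ∧
      (∀ p ∈ U ×ˢ (Set.univ : Set (Fin k → E)), W (Z p) = p) ∧
      (∀ p ∈ U ×ˢ (Set.univ : Set (Fin k → E)), Z (W p) = p)) ∧
    (∀ p : E × (Fin k → E), (Z p).1 = p.1) := by
  set F : Fin k → E × (Fin k → E) → E := fun i p => ((1 : ℝ) / (((i : ℕ) + 1 : ℕ) : ℝ)) •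
    ∑ j ∈ Finset.univ.filter (fun j : Fin k => 1 ≤ (j : ℕ) ∧ (j : ℕ) ≤ (i : ℕ)),
      ((((i : ℕ) + 1 - (j : ℕ) : ℕ)) : ℝ) •
        M (j : ℕ) p.1 (fun r : Fin (j : ℕ) => p.2 (Fin.castLE j.isLt.le r))
          (p.2 ⟨(i : ℕ) - (j : ℕ), Nat.lt_of_le_of_lt (Nat.sub_le _ _) i.isLt⟩) with hF
  have hZF : Z = fun p => (p.1, fun i => p.2 i + F i p) := funext hZ
  have hlower : ∀ i p q, p.1 = q.1 → (∀ r < i, p.2 r = q.2 r) → F i p = F i q := by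
    intro i p q h₁ h₂
    simp only [hF]
    congr 1
    refine Finset.sum_congr rfl fun j hj => ?_
    obtain ⟨hj₁, hj₂⟩ := (Finset.mem_filter.1 hj).2
    have hargs : (fun r : Fin (j : ℕ) => p.2 (Fin.castLE j.isLt.le r))
        = fun r : Fin (j : ℕ) => q.2 (Fin.castLE j.isLt.le r) :=
      funext fun r => h₂ _ (by
        have := r.isLt
        rw [Fin.lt_def, Fin.val_castLE]
        omega)
    rw [h₁, hargs, h₂ _ (by rw [Fin.lt_def]; simp only; omega)]
  have hsmooth : ∀ i, ContDiffOn ℝ (⊤ : ℕ∞) (F i) (U ×ˢ Set.univ) := by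
    intro i
    refine contDiffOn_const.smul (ContDiffOn.sum fun j hj => contDiffOn_const.smul ?_)
    obtain ⟨hj₁, -⟩ := (Finset.mem_filter.1 hj).2
    refine ContDiffOn.clm_apply ?_ (ContDiff.contDiffOn (by fun_prop))
    exact (hM j hj₁ (by omega)).comp
      (f := fun p : E × (Fin k → E) =>
        (p.1, fun r : Fin (j : ℕ) => p.2 (Fin.castLE j.isLt.le r)))
      (ContDiff.contDiffOn (by fun_prop)) fun p hp => ⟨hp.1, Set.mem_univ _⟩
  have hleft : Function.LeftInverse (fun z => triangularIterate F z k) Z := by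
    intro p
    rw [hZF]
    exact triangularIterate_leftInverse hlower p
  have hright : ∀ z, Z (triangularIterate F z k) = z := by
    intro z
    rw [hZF]
    exact triangularIterate_rightInverse hlower z
  have hfst : ∀ p, (Z p).1 = p.1 := fun p => by rw [hZF]
  refine ⟨⟨fun p hp => ⟨?_, Set.mem_univ _⟩, hleft.injective.injOn,
      fun z hz => ⟨triangularIterate F z k, ⟨?_, Set.mem_univ _⟩, hright z⟩⟩, ?_,
    ⟨fun z => triangularIterate F z k, contDiffOn_triangularIterate hsmooth k,
      fun p _ => hleft p, fun z _ => hright z⟩, hfst⟩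
  · rw [hfst]
    exact hp.1
  · rw [triangularIterate_fst]
    exact hz.1
  · rw [hZF]
    exact contDiff_fst.contDiffOn.prodMk (contDiffOn_pi.2 fun i =>
      ContDiffOn.add (ContDiff.contDiffOn (by fun_prop)) (hsmooth i))
end
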